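/- arXiv:1802.10578 — 3 statements merged into one kernel-verified Lean document; each statement's English description precedes it below -/
import Mathlib

section
/- Let d be a linear ℂ-derivation of B_n^2 (the Fermat ring with all exponents m_i = 2). Then there exist a unique scalar derivation d_α (whose associated matrix is a scalar matrix α·I, α ∈ ℂ) and a unique skew-symmetric derivation d_s (whose associated matrix is skew-symmetric) such that d = d_α + d_s. Equivalently, the associated matrix [a_{ij}] of d satisfies a_{11} = a_{22} = ⋯ = a_{nn} and a_{ij} = −a_{ji} for all i ≠ j. -/
open MvPolynomial

noncomputable section

/-- The Fermat ring `B_n^m = ℂ[X_1,…,X_n]/(X_1^{m_1}+⋯+X_n^{m_n})`. -/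
abbrev FermatRing (n : ℕ) (m : Fin n → ℕ) : Type :=
  MvPolynomial (Fin n) ℂ ⧸
    Ideal.span {(∑ i, X i ^ m i : MvPolynomial (Fin n) ℂ)}

/-- The image `x_i` of the variable `X_i` in the Fermat ring. -/
def fx (n : ℕ) (m : Fin n → ℕ) (i : Fin n) : FermatRing n m :=
  Ideal.Quotient.mk _ (X i)

/-- Evaluation at a point of the
quadric `v_1^2+⋯+v_n^2 = 0`. -/
def quadricEval {n : ℕ} (v : Fin n → ℂ) (hv : ∑ i, v i ^ 2 = 0) :
    FermatRing n (fun _ => 2) →ₐ[ℂ] ℂ :=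
  Ideal.Quotient.liftₐ _ (aeval v) (by
    have h : Ideal.span {(∑ i, X i ^ 2 : MvPolynomial (Fin n) ℂ)} ≤ RingHom.ker (aeval (R := ℂ) v) := by
      rw [Ideal.span_singleton_le_iff_mem, RingHom.mem_ker]
      simpa using hv
    exact fun a ha => h ha)

theorem quadricEval_fx {n : ℕ} (v : Fin n → ℂ) (hv : ∑ i, v i ^ 2 = 0) (i : Fin n) :
    quadricEval v hv (fx n (fun _ => 2) i) = v i :=
  (Ideal.Quotient.lift_mk _ _ _).trans (aeval_X v i)

theorem sum_fx_pow (n : ℕ) (m : Fin n → ℕ) : ∑ i, fx n m i ^ m i = 0 := by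
  have h := Ideal.Quotient.eq_zero_iff_mem.mpr
    (Ideal.mem_span_singleton_self (∑ i, X i ^ m i : MvPolynomial (Fin n) ℂ))
  simpa [fx] using h

theorem derivation_ext_fx {n : ℕ} {m : Fin n → ℕ}
    {D₁ D₂ : Derivation ℂ (FermatRing n m) (FermatRing n m)}
    (h : ∀ i, D₁ (fx n m i) = D₂ (fx n m i)) : D₁ = D₂ := by
  have key : D₁.compAlgebraMap (MvPolynomial (Fin n) ℂ) =
      D₂.compAlgebraMap (MvPolynomial (Fin n) ℂ) :=
    MvPolynomial.derivation_ext h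
  ext x
  obtain ⟨p, rfl⟩ := Ideal.Quotient.mk_surjective x
  exact DFunLike.congr_fun key p

theorem exists_euler_derivation (n : ℕ) :
    ∃ E : Derivation ℂ (FermatRing n fun _ => 2) (FermatRing n fun _ => 2),
      ∀ i, E (fx n (fun _ => 2) i) = fx n (fun _ => 2) i := by
  let S : MvPolynomial (Fin n) ℂ := ∑ i, X i ^ 2
  let D : Derivation ℂ (MvPolynomial (Fin n) ℂ) (MvPolynomial (Fin n) ℂ) := mkDerivation ℂ X
  have hS : D S = 2 * S := by
    simp only [S, D, map_sum, Derivation.leibniz_pow, mkDerivation_X, Finset.mul_sum]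
    refine Finset.sum_congr rfl fun i _ => ?_
    simp [pow_two]
  let f := Ideal.Quotient.mkₐ ℂ (Ideal.span {S})
  have hf : Function.Surjective f := Ideal.Quotient.mkₐ_surjective _ _
  have hD : ∀ p, f p = 0 → f (D p) = 0 := by
    intro p hp
    obtain ⟨q, rfl⟩ := Ideal.mem_span_singleton'.mp (Ideal.Quotient.eq_zero_iff_mem.mp hp)
    refine Ideal.Quotient.eq_zero_iff_mem.mpr (Ideal.mem_span_singleton.mpr ?_)
    rw [Derivation.leibniz, hS]
    exact ⟨2 * q + D q, by simp only [smul_eq_mul]; ring⟩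
  refine ⟨Derivation.liftOfSurjective hf hD, fun i => ?_⟩
  change Derivation.liftOfSurjective hf hD (f (X i)) = f (X i)
  rw [Derivation.liftOfSurjective_apply]
  simp [D]

/-- The point with coordinates `1` at `i`, `c` at `j` and `0` elsewhere lies on the quadric. -/
theorem sum_single_add_single_sq {n : ℕ} {i j : Fin n} (hij : i ≠ j) {c : ℂ} (hc : c ^ 2 = -1) :
    ∑ k, (Pi.single i 1 + Pi.single j c : Fin n → ℂ) k ^ 2 = 0 := by
  have h : ∀ k, (Pi.single i 1 + Pi.single j c : Fin n → ℂ) k ^ 2 =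
      (Pi.single i 1 : Fin n → ℂ) k + (Pi.single j (-1) : Fin n → ℂ) k := by
    intro k
    by_cases hi : k = i
    · subst hi; simp [hij]
    · by_cases hj : k = j
      · subst hj; simp [hi, hc]
      · simp [hi, hj]
  simp_rw [h]
  simp [Finset.sum_add_distrib]

theorem linearIndependent_fx {n : ℕ} (hn : 2 ≤ n) :
    LinearIndependent ℂ (fx n fun _ => 2) := by
  rw [Fintype.linearIndependent_iff]
  intro g hg i
  have : Nontrivial (Fin n) := Fin.nontrivial_iff_two_le.mpr hn
  obtain ⟨j, hj⟩ := exists_ne i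
  have key : ∀ c : ℂ, c ^ 2 = -1 → g i + g j * c = 0 := by
    intro c hc
    have h := congrArg (quadricEval _ (sum_single_add_single_sq hj.symm hc)) hg
    simpa [quadricEval_fx, mul_add, Finset.sum_add_distrib, Pi.single_apply] using h
  linear_combination (key Complex.I (by simp) + key (-Complex.I) (by simp)) / 2

theorem sum_mul_eq_zero_of_linear_derivation {n : ℕ}
    {d : Derivation ℂ (FermatRing n fun _ => 2) (FermatRing n fun _ => 2)}
    {a : Matrix (Fin n) (Fin n) ℂ}
    (hd : ∀ i, d (fx n (fun _ => 2) i) = ∑ j, a i j • fx n (fun _ => 2) j)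
    {v : Fin n → ℂ} (hv : ∑ i, v i ^ 2 = 0) :
    ∑ i, v i * ∑ j, a i j * v j = 0 := by
  have h := congrArg (fun x => quadricEval v hv (d x)) (sum_fx_pow n fun _ => 2)
  simp only [map_sum, Derivation.leibniz_pow, hd, map_zero, map_nsmul, smul_eq_mul, map_mul,
    map_smul, Nat.add_one_sub_one, pow_one, quadricEval_fx, ← Finset.smul_sum] at h
  exact (smul_eq_zero.mp h).resolve_left two_ne_zero

theorem linear_derivation_matrix {n : ℕ}
    {d : Derivation ℂ (FermatRing n fun _ => 2) (FermatRing n fun _ => 2)}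
    {a : Matrix (Fin n) (Fin n) ℂ}
    (hd : ∀ i, d (fx n (fun _ => 2) i) = ∑ j, a i j • fx n (fun _ => 2) j)
    {i j : Fin n} (hij : i ≠ j) : a i i = a j j ∧ a i j = -a j i := by
  have key : ∀ c : ℂ, c ^ 2 = -1 → a i i + a i j * c + c * (a j i + a j j * c) = 0 := by
    intro c hc
    have h := sum_mul_eq_zero_of_linear_derivation hd (sum_single_add_single_sq hij hc)
    simp [mul_add, add_mul, Finset.sum_add_distrib, Pi.single_apply] at h
    linear_combination h
  have h₁ := key Complex.I (by simp)
  have h₂ := key (-Complex.I) (by simp)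
  constructor
  · linear_combination (h₁ + h₂) / 2 - a j j * Complex.I_sq
  · linear_combination -Complex.I * (h₁ - h₂) / 2 + (a i j + a j i) * Complex.I_sq

/-- Every linear ℂ-derivation of `B_n^2` decomposes uniquely as
a sum of a scalar derivation and a skew-symmetric derivation; equivalently, its
associated matrix has constant diagonal and skew-symmetric off-diagonal part. -/
theorem linear_derivation_scalar_add_skew
    (n : ℕ) (hn : 3 ≤ n)
    (d : Derivation ℂ (FermatRing n fun _ => 2) (FermatRing n fun _ => 2))
    (a : Matrix (Fin n) (Fin n) ℂ)
    (hd : ∀ i, d (fx n (fun _ => 2) i) = ∑ j, a i j • fx n (fun _ => 2) j) :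
    (∃! p : Derivation ℂ (FermatRing n fun _ => 2) (FermatRing n fun _ => 2) ×
            Derivation ℂ (FermatRing n fun _ => 2) (FermatRing n fun _ => 2),
      (∃ α : ℂ, ∀ i, p.1 (fx n (fun _ => 2) i) = α • fx n (fun _ => 2) i) ∧
      (∃ s : Matrix (Fin n) (Fin n) ℂ, s.transpose = -s ∧
        ∀ i, p.2 (fx n (fun _ => 2) i) = ∑ j, s i j • fx n (fun _ => 2) j) ∧
      d = p.1 + p.2) ∧
    (∀ i j, a i i = a j j) ∧ (∀ i j, i ≠ j → a i j = -a j i) := by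
  have hdiag : ∀ i j, a i i = a j j := fun i j => by
    by_cases h : i = j
    · rw [h]
    · exact (linear_derivation_matrix hd h).1
  have hskew : ∀ i j, i ≠ j → a i j = -a j i := fun i j h => (linear_derivation_matrix hd h).2
  refine ⟨?_, hdiag, hskew⟩
  let i₀ : Fin n := ⟨0, by omega⟩
  obtain ⟨E, hE⟩ := exists_euler_derivation n
  have hscalar : ∀ (α : ℂ) (i : Fin n), α • fx n (fun _ => 2) i =
      ∑ j, (α • (1 : Matrix (Fin n) (Fin n) ℂ)) i j • fx n (fun _ => 2) j := fun α i => by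
    simp [Matrix.one_apply]
  refine ⟨(a i₀ i₀ • E, d - a i₀ i₀ • E), ⟨⟨a i₀ i₀, fun i => by simp [hE]⟩,
    ⟨a - a i₀ i₀ • 1, ?_, fun i => ?_⟩, Derivation.ext fun x => by simp⟩, ?_⟩
  · ext i j
    by_cases h : i = j
    · subst h
      simp [hdiag i i₀]
    · simp [hskew j i (Ne.symm h), h, Ne.symm h]
  · rw [Derivation.sub_apply, Derivation.smul_apply, hE, hd, hscalar, ← Finset.sum_sub_distrib]
    simp only [← sub_smul, Matrix.sub_apply]
  · rintro ⟨p, q⟩ ⟨⟨α, hp⟩, ⟨s, hs, hq⟩, hpq⟩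
    dsimp only at hp hq hpq
    have hα : α = a i₀ i₀ := by
      have h : ∑ j, (a - α • 1 - s) i₀ j • fx n (fun _ => 2) j = 0 := by
        simp only [Matrix.sub_apply, sub_smul, Finset.sum_sub_distrib]
        rw [← hd, ← hscalar, ← hq, ← hp, hpq, Derivation.add_apply]
        abel
      have h₀ := Fintype.linearIndependent_iff.mp (linearIndependent_fx (by omega)) _ h i₀
      have hs₀ : s i₀ i₀ = -s i₀ i₀ := congrFun (congrFun hs i₀) i₀
      simp only [Matrix.sub_apply, Matrix.smul_apply, Matrix.one_apply_eq, smul_eq_mul] at h₀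
      linear_combination -h₀ - hs₀ / 2
    have hpE : p = a i₀ i₀ • E := derivation_ext_fx fun i => by
      rw [hp, Derivation.smul_apply, hE, hα]
    rw [hpq, ← hpE]
    exact Prod.ext rfl (add_sub_cancel_left p q).symm
end
end

section
/- Let d be the ℂ-derivation of the Fermat ring B_n^m (with each m_i ≥ 3) given by d(x_i) = (α/m_i) x_i for all i, where α ∈ ℂ is nonzero. Suppose f = Σ_{(i_1,…,i_n) ∈ I} a_{(i_1,…,i_n)} x_1^{i_1}⋯x_n^{i_n} with all coefficients a_{(i_1,…,i_n)} nonzero and exponents i_n < m_n, and d(f) = λf for some λ ∈ B_n^m. Then λ = α(i_1/m_1 + i_2/m_2 + ⋯ + i_n/m_n) for every (i_1,…,i_n) ∈ I; in particular the weighted degree Σ_j i_j/m_j is the same for all multi-indices in the support of f. -/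
open MvPolynomial

noncomputable section

lemma fermat_squarefree_factor {k : ℕ} (hk : 2 ≤ k) (m : Fin k → ℕ) (hm : ∀ i, m i ≠ 0)
    {p : MvPolynomial (Fin k) ℂ} (hp : Prime p) : ¬ p ^ 2 ∣ ∑ i, X i ^ m i := by
  rintro ⟨q, hq⟩
  have key : ∀ i, p ∣ (X i : MvPolynomial (Fin k) ℂ) := by
    intro i
    have h := congrArg (pderiv i) hq
    have hl : pderiv i (∑ j, X j ^ m j : MvPolynomial (Fin k) ℂ)
        = C (m i : ℂ) * X i ^ (m i - 1) := by
      rw [map_sum, Finset.sum_eq_single i]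
      · simp [Derivation.leibniz_pow]
      · intro j _ hj
        simp [Derivation.leibniz_pow, pderiv_X_of_ne hj]
      · simp
    have h1 : p ∣ C (m i : ℂ) * X i ^ (m i - 1) := by
      rw [← hl, h]
      refine ⟨p * pderiv i q + 2 * q * pderiv i p, ?_⟩
      simp [Derivation.leibniz, Derivation.leibniz_pow]
      ring
    have hu : IsUnit (C (m i : ℂ) : MvPolynomial (Fin k) ℂ) :=
      (isUnit_iff_ne_zero.2 (Nat.cast_ne_zero.2 (hm i))).map C
    exact hp.dvd_of_dvd_pow (hu.dvd_mul_left.1 h1)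
  have h0 := key ⟨0, by omega⟩
  have h1 := key ⟨1, by omega⟩
  have := (hp.irreducible.associated_of_dvd X_prime.irreducible h0).symm.dvd.trans h1
  simp [MvPolynomial.X_dvd_X] at this

lemma prime_fermat {k : ℕ} (hk : 2 ≤ k) (m : Fin (k + 1) → ℕ) (hm : ∀ i, m i ≠ 0) :
    Prime (∑ i, X i ^ m i : MvPolynomial (Fin (k + 1)) ℂ) := by
  rw [← MulEquiv.prime_iff (finSuccEquiv ℂ k)]
  set g : MvPolynomial (Fin k) ℂ := ∑ i, X i ^ m i.succ with hg
  have e : finSuccEquiv ℂ k (∑ i, X i ^ m i) = Polynomial.X ^ m 0 + Polynomial.C g := by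
    simp [Fin.sum_univ_succ, finSuccEquiv_X_zero, finSuccEquiv_X_succ, hg]
  rw [e]
  have hg0 : g ≠ 0 := by
    intro h
    exact fermat_squarefree_factor hk _ (fun i => hm i.succ) 
      (X_prime (i := (⟨0, by omega⟩ : Fin k))) (by rw [← hg, h]; exact dvd_zero _)
  have hcoeff : constantCoeff g = 0 := by simp [hg, hm]
  have hgu : ¬ IsUnit g := fun h => by
    simpa [hcoeff] using h.map (constantCoeff (R := ℂ) (σ := Fin k))
  obtain ⟨p, hp, hpg⟩ := WfDvdMonoid.exists_irreducible_factor hgu hg0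
  have hmonic : (Polynomial.X ^ m 0 + Polynomial.C g).Monic := Polynomial.monic_X_pow_add_C g (hm 0)
  rw [← irreducible_iff_prime]
  refine Polynomial.irreducible_of_eisenstein_criterion (P := Ideal.span {p})
    ((Ideal.span_singleton_prime hp.ne_zero).2 hp.prime) ?_ ?_ ?_ ?_ hmonic.isPrimitive
  · rw [hmonic.leadingCoeff, Ideal.mem_span_singleton]
    exact fun h => hp.not_isUnit (isUnit_of_dvd_one h)
  · intro j hj
    rw [Polynomial.degree_X_pow_add_C (Nat.pos_of_ne_zero (hm 0))] at hj
    have hj' : j < m 0 := by exact_mod_cast hj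
    rw [Ideal.mem_span_singleton, Polynomial.coeff_add, Polynomial.coeff_X_pow, if_neg hj'.ne,
      zero_add, Polynomial.coeff_C]
    split_ifs
    · exact hpg
    · exact dvd_zero _
  · rw [Polynomial.degree_X_pow_add_C (Nat.pos_of_ne_zero (hm 0))]
    exact_mod_cast Nat.pos_of_ne_zero (hm 0)
  · rw [Ideal.span_singleton_pow, Ideal.mem_span_singleton]
    simpa [Polynomial.coeff_X_pow, (hm 0).symm] using
      fermat_squarefree_factor hk _ (fun i => hm i.succ) hp.prime

/-- The Fermat ring in at least three variables is a domain. -/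
lemma isDomain_fermatRing {n : ℕ} (hn : 3 ≤ n) (m : Fin n → ℕ) (hm : ∀ i, m i ≠ 0) :
    IsDomain (FermatRing n m) := by
  obtain ⟨k, rfl⟩ : ∃ k, n = k + 1 := ⟨n - 1, by omega⟩
  have h := prime_fermat (k := k) (by omega) m hm
  exact (Ideal.Quotient.isDomain_iff_prime _).2 ((Ideal.span_singleton_prime h.ne_zero).2 h)

/-- Monomials whose exponent at `i₀` is below `m i₀` are linearly independent in the Fermat
ring. -/
lemma sum_monomials_ne_zero {n : ℕ} (m : Fin n → ℕ) (i₀ : Fin n) (hm : 0 < m i₀)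
    (J : Finset (Fin n → ℕ)) (hJ : J.Nonempty) (a : (Fin n → ℕ) → ℂ)
    (ha : ∀ v ∈ J, a v ≠ 0) (hlt : ∀ v ∈ J, v i₀ < m i₀) :
    ∑ v ∈ J, algebraMap ℂ (FermatRing n m) (a v) * ∏ j, fx n m j ^ v j ≠ 0 := by
  set F : MvPolynomial (Fin n) ℂ := ∑ i, X i ^ m i with hF
  set P : MvPolynomial (Fin n) ℂ :=
    ∑ v ∈ J, monomial (Finsupp.equivFunOnFinite.symm v) (a v) with hP
  have hmk : Ideal.Quotient.mk (Ideal.span {F}) P =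
      ∑ v ∈ J, algebraMap ℂ (FermatRing n m) (a v) * ∏ j, fx n m j ^ v j := by
    rw [hP, map_sum]
    refine Finset.sum_congr rfl fun v _ => ?_
    rw [monomial_eq, Finsupp.prod_fintype _ _ (by simp), map_mul, map_prod]
    simp only [map_pow]
    rfl
  have hcoeff : ∀ s : Fin n →₀ ℕ, coeff s P = if ⇑s ∈ J then a s else 0 := by
    intro s
    rw [hP, coeff_sum]
    simp only [coeff_monomial]
    rw [← Finset.sum_ite_eq J (⇑s) a]
    refine Finset.sum_congr rfl fun v _ => ?_
    congr 1
    exact propext ((Equiv.symm_apply_eq _).trans eq_comm)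
  have hP0 : P ≠ 0 := by
    obtain ⟨v, hv⟩ := hJ
    intro h
    have := hcoeff (Finsupp.equivFunOnFinite.symm v)
    rw [h] at this
    simp [hv] at this
    exact ha v hv this.symm
  have hPdeg : degreeOf i₀ P < m i₀ := by
    rw [degreeOf_lt_iff hm]
    intro s hs
    rw [mem_support_iff, hcoeff] at hs
    exact hlt s (by by_contra h; simp [h] at hs)
  have hFdeg : m i₀ ≤ degreeOf i₀ F := by
    have hs : Finsupp.single i₀ (m i₀) ∈ F.support := by
      rw [mem_support_iff, hF, coeff_sum, Finset.sum_eq_single i₀]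
      · simp [coeff_X_pow]
      · intro j _ hj
        rw [coeff_X_pow, if_neg]
        intro h
        have := DFunLike.congr_fun h i₀
        simp [hj.symm] at this
        omega
      · simp
    simpa using monomial_le_degreeOf i₀ hs
  rw [← hmk, Ne, Ideal.Quotient.eq_zero_iff_dvd]
  rintro ⟨Q, hQ⟩
  have hF0 : F ≠ 0 := by rintro h; simp [h] at hQ; exact hP0 hQ
  have hQ0 : Q ≠ 0 := by rintro rfl; simp at hQ; exact hP0 hQ
  rw [hQ, degreeOf_mul_eq hF0 hQ0] at hPdeg
  omega

/-- The weight `∏ m / m i` of `x_i`, for which the Fermat polynomial is homogeneous. -/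
def fermatWeight {n : ℕ} (m : Fin n → ℕ) (i : Fin n) : ℕ := ∏ j ∈ Finset.univ.erase i, m j

lemma fermatWeight_mul {n : ℕ} (m : Fin n → ℕ) (i : Fin n) :
    fermatWeight m i * m i = ∏ j, m j := Finset.prod_erase_mul _ _ (Finset.mem_univ i)

lemma Polynomial.sum_C_mul_X_pow_pow {A ι : Type*} [CommRing A] [Fintype ι] (y : ι → A)
    (w m : ι → ℕ) (N : ℕ) (h : ∀ i, w i * m i = N) :
    ∑ i, (Polynomial.C (y i) * Polynomial.X ^ w i) ^ m i =
      Polynomial.C (∑ i, y i ^ m i) * Polynomial.X ^ N := by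
  simp only [mul_pow, ← pow_mul, h, map_sum, map_pow, Finset.sum_mul]

lemma Polynomial.prod_C_mul_X_pow_pow {A ι : Type*} [CommRing A] [Fintype ι] (y : ι → A)
    (w v : ι → ℕ) :
    ∏ i, (Polynomial.C (y i) * Polynomial.X ^ w i) ^ v i =
      Polynomial.monomial (∑ i, w i * v i) (∏ i, y i ^ v i) := by
  simp only [← Polynomial.C_mul_X_pow_eq_monomial, mul_pow, ← pow_mul, Finset.prod_mul_distrib,
    Finset.prod_pow_eq_pow_sum, map_prod, map_pow]

lemma mul_sum_div_eq_fermatWeight {n : ℕ} {m : Fin n → ℕ} (hm : ∀ i, m i ≠ 0) (α : ℂ)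
    (v : Fin n → ℕ) :
    α * ∑ j, (v j : ℂ) / (m j : ℂ) =
      α / (∏ j, (m j : ℂ)) * (∑ j, fermatWeight m j * v j : ℕ) := by
  have hM : (∏ j, (m j : ℂ)) ≠ 0 :=
    Finset.prod_ne_zero_iff.2 fun j _ => Nat.cast_ne_zero.2 (hm j)
  rw [Nat.cast_sum, Finset.mul_sum, Finset.mul_sum]
  refine Finset.sum_congr rfl fun j _ => ?_
  have h1 : (fermatWeight m j : ℂ) * m j = ∏ j, (m j : ℂ) := by
    exact_mod_cast fermatWeight_mul m j
  have h2 : (m j : ℂ) ≠ 0 := Nat.cast_ne_zero.2 (hm j)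
  have h3 : (fermatWeight m j : ℂ) ≠ 0 := by
    intro h
    exact hM (by rw [← h1, h, zero_mul])
  rw [← h1]
  push_cast
  field_simp

/-- The coaction `x_i ↦ x_i t^{w_i}` encoding the weight grading of the Fermat ring. -/
def fermatCoaction (n : ℕ) (m : Fin n → ℕ) :
    FermatRing n m →ₐ[ℂ] Polynomial (FermatRing n m) :=
  Ideal.Quotient.liftₐ _
    (aeval fun i => Polynomial.C (fx n m i) * Polynomial.X ^ fermatWeight m i) (by
      have hF : (∑ i, fx n m i ^ m i) = 0 := by
        have := Ideal.Quotient.eq_zero_iff_mem.2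
          (Ideal.mem_span_singleton_self (∑ i, X i ^ m i : MvPolynomial (Fin n) ℂ))
        simpa [fx] using this
      intro p hp
      obtain ⟨q, rfl⟩ := Ideal.mem_span_singleton.1 hp
      rw [map_mul, map_sum]
      simp only [map_pow, aeval_X]
      rw [Polynomial.sum_C_mul_X_pow_pow (fx n m) _ m _ (fermatWeight_mul m), hF, Polynomial.C_0,
        zero_mul, zero_mul])

@[simp] lemma fermatCoaction_fx (n : ℕ) (m : Fin n → ℕ) (i : Fin n) :
    fermatCoaction n m (fx n m i) = Polynomial.C (fx n m i) * Polynomial.X ^ fermatWeight m i := by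
  change aeval _ (X i) = _
  simp

lemma fermatCoaction_monomial (n : ℕ) (m : Fin n → ℕ) (v : Fin n → ℕ) :
    fermatCoaction n m (∏ j, fx n m j ^ v j) =
      Polynomial.monomial (∑ j, fermatWeight m j * v j) (∏ j, fx n m j ^ v j) := by
  simp only [map_prod, map_pow, fermatCoaction_fx]
  exact Polynomial.prod_C_mul_X_pow_pow _ _ _

lemma eval_one_fermatCoaction (n : ℕ) (m : Fin n → ℕ) (b : FermatRing n m) :
    (fermatCoaction n m b).eval 1 = b := by
  have h : ((Polynomial.aeval (R := FermatRing n m) (1 : FermatRing n m)).restrictScalars ℂ).comp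
      (fermatCoaction n m) = AlgHom.id ℂ _ := by
    refine Ideal.Quotient.algHom_ext _ (MvPolynomial.algHom_ext fun i => ?_)
    change Polynomial.aeval (1 : FermatRing n m) (fermatCoaction n m (fx n m i)) = fx n m i
    simp
  simpa [Polynomial.coe_aeval_eq_eval] using DFunLike.congr_fun h b

/-- A derivation scaling each `y j` by `c j` scales monomials by the corresponding weight. -/
lemma Derivation.apply_monomial_of_diagonal {R A ι : Type*} [CommRing R] [CommRing A]
    [Algebra R A] (d : Derivation R A A) (y : ι → A) (c : ι → R)
    (hd : ∀ i, d (y i) = c i • y i) (v : ι → ℕ) (s : Finset ι) :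
    d (∏ j ∈ s, y j ^ v j) = (∑ j ∈ s, (v j : R) * c j) • ∏ j ∈ s, y j ^ v j := by
  classical
  have hpow : ∀ (i : ι) (k : ℕ), d (y i ^ k) = ((k : R) * c i) • y i ^ k := by
    intro i k
    rw [d.leibniz_pow, hd]
    rcases k with _ | k
    · simp
    · simp only [nsmul_eq_mul, smul_eq_mul, Nat.add_sub_cancel]
      simp only [Algebra.smul_def, map_mul, _root_.map_natCast]
      ring
  induction s using Finset.induction_on with
  | empty => simp
  | insert i s hi ih =>
    rw [Finset.prod_insert hi, Finset.sum_insert hi, d.leibniz, ih, hpow]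
    simp only [smul_eq_mul]
    simp only [Algebra.smul_def, map_add]
    ring

lemma coeff_map_sum {R A σ : Type*} [CommRing R] [CommRing A] [Algebra R A]
    (φ : A →ₐ[R] Polynomial A) (wt : σ → ℕ) (mon : σ → A)
    (h : ∀ v, φ (mon v) = Polynomial.monomial (wt v) (mon v)) (I : Finset σ) (c : σ → R) (k : ℕ) :
    (φ (∑ v ∈ I, algebraMap R A (c v) * mon v)).coeff k =
      ∑ v ∈ I with wt v = k, algebraMap R A (c v) * mon v := by
  simp only [← Algebra.smul_def]
  rw [map_sum, Polynomial.finsetSum_coeff, Finset.sum_filter]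
  refine Finset.sum_congr rfl fun v _ => ?_
  rw [map_smul, h, Polynomial.coeff_smul, Polynomial.coeff_monomial]
  split_ifs <;> simp

lemma coeff_map_derivation {R A σ : Type*} [CommRing R] [CommRing A] [Algebra R A]
    (φ : A →ₐ[R] Polynomial A) (wt : σ → ℕ) (mon : σ → A)
    (h : ∀ v, φ (mon v) = Polynomial.monomial (wt v) (mon v)) (d : Derivation R A A) (c : R)
    (hd : ∀ v, d (mon v) = (c * wt v) • mon v) (I : Finset σ) (a : σ → R) {f : A}
    (hf : f = ∑ v ∈ I, algebraMap R A (a v) * mon v) (k : ℕ) :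
    (φ (d f)).coeff k = algebraMap R A (c * k) * (φ f).coeff k := by
  have hdf : d f = ∑ v ∈ I, algebraMap R A (c * wt v * a v) * mon v := by
    rw [hf, map_sum]
    refine Finset.sum_congr rfl fun v _ => ?_
    rw [← Algebra.smul_def, d.map_smul, hd, smul_smul, ← Algebra.smul_def, mul_comm]
  rw [hdf, hf, coeff_map_sum φ wt mon h, coeff_map_sum φ wt mon h, Finset.mul_sum]
  refine Finset.sum_congr rfl fun v hv => ?_
  rw [(Finset.mem_filter.1 hv).2, map_mul, mul_assoc]

/-- If `g = lam * f` in a graded domain, where the degree `k` component of `g` is `c * k` times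
that of `f`, then `lam = c * k` whenever the degree `k` component of `f` is nonzero. -/
lemma eigenvalue_of_coaction {R A : Type*} [CommRing R] [CommRing A] [IsDomain A] [Algebra R A]
    (φ : A →ₐ[R] Polynomial A) (hφ : ∀ b, (φ b).eval 1 = b) {f g lam : A} (hlam : g = lam * f)
    {c : R} (hg : ∀ k : ℕ, (φ g).coeff k = algebraMap R A (c * k) * (φ f).coeff k)
    {k : ℕ} (hne : (φ f).coeff k ≠ 0) : lam = algebraMap R A (c * k) := by
  have hφf : φ f ≠ 0 := fun h => hne (by rw [h, Polynomial.coeff_zero])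
  have hmul : φ g = φ lam * φ f := by rw [hlam, map_mul]
  have hdeg : (φ lam).natDegree = 0 := by
    by_cases h0 : φ lam = 0
    · rw [h0, Polynomial.natDegree_zero]
    have h1 : (φ g).natDegree ≤ (φ f).natDegree := by
      refine Polynomial.natDegree_le_iff_coeff_eq_zero.2 fun k hk => ?_
      rw [hg, Polynomial.coeff_eq_zero_of_natDegree_lt hk, mul_zero]
    rw [hmul, Polynomial.natDegree_mul h0 hφf] at h1
    omega
  have hconst : φ lam = Polynomial.C lam := by
    have h := Polynomial.eq_C_of_natDegree_eq_zero hdeg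
    have h1 := hφ lam
    rw [h, Polynomial.eval_C] at h1
    rw [h, h1]
  have h := hg k
  rw [hmul, hconst, Polynomial.coeff_C_mul] at h
  exact mul_right_cancel₀ hne h

/-- Let `d` be the derivation `d(x_i) = (α/m_i) x_i` (α ≠ 0) of
`B_n^m` with all `m_i ≥ 3`. If `f = Σ_{v ∈ I} a_v x^v` (all `a_v ≠ 0`, exponents
of `x_n` below `m_n`) is a Darboux element with `d(f) = λ f`, then
`λ = α (v_1/m_1 + ⋯ + v_n/m_n)` for every multi-index `v ∈ I`. -/
theorem darboux_eigenvalue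
    (n : ℕ) (hn : 3 ≤ n) (m : Fin n → ℕ) (hm : ∀ i, 3 ≤ m i)
    (α : ℂ) (hα : α ≠ 0)
    (d : Derivation ℂ (FermatRing n m) (FermatRing n m))
    (hd : ∀ i, d (fx n m i) = (α / (m i : ℂ)) • fx n m i)
    (I : Finset (Fin n → ℕ)) (a : (Fin n → ℕ) → ℂ)
    (ha : ∀ v ∈ I, a v ≠ 0)
    (hlast : ∀ v ∈ I, v ⟨n - 1, by omega⟩ < m ⟨n - 1, by omega⟩)
    (f : FermatRing n m)
    (hf : f = ∑ v ∈ I, algebraMap ℂ (FermatRing n m) (a v) * ∏ j, fx n m j ^ v j)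
    (lam : FermatRing n m) (hlam : d f = lam * f) :
    ∀ v ∈ I, lam = algebraMap ℂ (FermatRing n m)
      (α * ∑ j, (v j : ℂ) / (m j : ℂ)) := by
  have hm0 : ∀ i, m i ≠ 0 := fun i => by have := hm i; omega
  have := isDomain_fermatRing hn m hm0
  have hdmon : ∀ v : Fin n → ℕ, d (∏ j, fx n m j ^ v j) =
      (α / (∏ j, (m j : ℂ)) * (∑ j, fermatWeight m j * v j : ℕ)) • ∏ j, fx n m j ^ v j := by
    intro v
    rw [d.apply_monomial_of_diagonal _ _ hd, ← mul_sum_div_eq_fermatWeight hm0, Finset.mul_sum]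
    congr 2
    funext j
    ring
  intro v hv
  rw [mul_sum_div_eq_fermatWeight hm0]
  refine eigenvalue_of_coaction (fermatCoaction n m) (eval_one_fermatCoaction n m) hlam
    (coeff_map_derivation _ _ _ (fermatCoaction_monomial n m) d _ hdmon I a hf) ?_
  rw [hf, coeff_map_sum _ _ _ (fermatCoaction_monomial n m)]
  refine sum_monomials_ne_zero m ⟨n - 1, by omega⟩ (Nat.pos_of_ne_zero (hm0 _)) _ ?_ a ?_ ?_
  · exact ⟨v, Finset.mem_filter.2 ⟨hv, rfl⟩⟩
  · intro u hu
    exact ha u (Finset.mem_filter.1 hu).1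
  · intro u hu
    exact hlast u (Finset.mem_filter.1 hu).1
end
end

section
/- Let d = d_α + d_s be a linear ℂ-derivation of B_n^2, where d_α(x_i) = α x_i for all i with α ∈ ℂ nonzero, and d_s is a skew-symmetric derivation. If d_s is locally nilpotent, then ker(d) = ℂ. -/
open MvPolynomial

noncomputable section

/-- Two derivations of a Fermat ring which agree on the generators `x_i` are equal. -/
theorem FermatRing.derivation_ext {n : ℕ} {m : Fin n → ℕ}
    {d e : Derivation ℂ (FermatRing n m) (FermatRing n m)}
    (h : ∀ i, d (fx n m i) = e (fx n m i)) : d = e := by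
  refine Derivation.ext_of_adjoin_eq_top (Set.range (fx n m)) ?_ ?_
  · have hr : Set.range (fx n m) =
        Set.image (Ideal.Quotient.mkₐ ℂ
          (Ideal.span {(∑ i, X i ^ m i : MvPolynomial (Fin n) ℂ)})) (Set.range X) := by
      rw [← Set.range_comp]; rfl
    rw [hr, ← AlgHom.map_adjoin, MvPolynomial.adjoin_range_X, Algebra.map_top,
      AlgHom.range_eq_top]
    exact Ideal.Quotient.mkₐ_surjective _ _
  · rintro _ ⟨i, rfl⟩
    exact h i

/-- A derivation scaling each generator by `α` scales a monomial by `α` times its degree. -/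
theorem FermatRing.derivation_mk_monomial {n : ℕ} {m : Fin n → ℕ} {α : ℂ}
    {d : Derivation ℂ (FermatRing n m) (FermatRing n m)}
    (hd : ∀ i, d (fx n m i) = α • fx n m i) (u : Fin n →₀ ℕ) :
    d (Ideal.Quotient.mk _ (monomial u 1)) =
      ((u.degree : ℂ) * α) • (Ideal.Quotient.mk _ (monomial u 1) : FermatRing n m) := by
  induction u using Finsupp.induction_linear with
  | zero =>
    have h1 : (monomial 0 1 : MvPolynomial (Fin n) ℂ) = 1 := rfl
    simp [h1]
  | add u v hu hv =>
    have h1 : (monomial (u + v) 1 : MvPolynomial (Fin n) ℂ) = monomial u 1 * monomial v 1 := by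
      simp [monomial_mul]
    rw [h1, map_mul, Derivation.leibniz, hu, hv, map_add]
    simp only [smul_eq_mul, mul_smul_comm, Nat.cast_add]
    rw [mul_comm (Ideal.Quotient.mk _ (monomial v 1)), ← add_smul]
    congr 1
    ring
  | single i k =>
    rw [← X_pow_eq_monomial, map_pow, Derivation.leibniz_pow]
    have h1 := hd i
    unfold fx at h1
    rw [h1]
    rcases k with _ | k
    · simp
    · simp only [Nat.add_sub_cancel, Finsupp.degree_single, smul_eq_mul, mul_smul_comm, pow_succ,
        mul_smul, Nat.cast_smul_eq_nsmul]

/-- The image of a homogeneous component of degree `k` is an eigenvector, with eigenvalue `k α`,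
of a derivation scaling each generator by `α`. -/
theorem FermatRing.mk_homogeneousComponent_mem_eigenspace {n : ℕ} {m : Fin n → ℕ} {α : ℂ}
    {d : Derivation ℂ (FermatRing n m) (FermatRing n m)}
    (hd : ∀ i, d (fx n m i) = α • fx n m i) (k : ℕ) (p : MvPolynomial (Fin n) ℂ) :
    (Ideal.Quotient.mk _ (homogeneousComponent k p) : FermatRing n m) ∈
      Module.End.eigenspace (d : Module.End ℂ (FermatRing n m)) ((k : ℂ) * α) := by
  rw [homogeneousComponent_apply, map_sum]
  refine Submodule.sum_mem _ fun u hu => ?_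
  have h1 : monomial u (coeff u p) = coeff u p • monomial u (1 : ℂ) := by
    simp [smul_monomial]
  have h2 : (Ideal.Quotient.mk _ (monomial u (coeff u p)) : FermatRing n m) =
      coeff u p • (Ideal.Quotient.mk _ (monomial u 1) : FermatRing n m) := by
    rw [h1]; rfl
  rw [h2]
  refine Submodule.smul_mem _ _ (Module.End.mem_eigenspace_iff.2 ?_)
  rw [← (Finset.mem_filter.1 hu).2]
  exact derivation_mk_monomial hd u

/-- Eigenvectors of an endomorphism for distinct eigenvalues which sum to zero all vanish. -/
theorem Module.End.eq_zero_of_sum_mem_eigenspace_eq_zero {K V ι : Type*} [Field K]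
    [AddCommGroup V] [Module K V] (T : Module.End K V) {μ : ι → K}
    (hμ : Function.Injective μ) {s : Finset ι} {v : ι → V}
    (hv : ∀ i ∈ s, v i ∈ T.eigenspace (μ i)) (h : ∑ i ∈ s, v i = 0) :
    ∀ i ∈ s, v i = 0 :=
  (iSupIndep_iff_finsetSum_eq_zero_imp_eq_zero _).1
    (T.eigenspaces_iSupIndep.comp hμ) s v hv h

/-- A power of an endomorphism acts on an eigenvector by the power of the eigenvalue. -/
theorem Module.End.pow_apply_of_mem_eigenspace {R V : Type*} [CommRing R] [AddCommGroup V]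
    [Module R V] {T : Module.End R V} {μ : R} {v : V} (hv : v ∈ T.eigenspace μ) (t : ℕ) :
    (T ^ t) v = μ ^ t • v := by
  induction t with
  | zero => simp
  | succ t ih =>
    rw [pow_succ, Module.End.mul_apply, Module.End.mem_eigenspace_iff.1 hv, map_smul, ih,
      smul_smul, pow_succ']

/-- If `S` and `T` commute and `(T + S) v = 0`, then `T` is nilpotent on `v` whenever `S` is. -/
theorem Module.End.pow_apply_eq_zero_of_commute {R V : Type*} [CommRing R] [AddCommGroup V]
    [Module R V] {T S : Module.End R V} (hTS : Commute T S) {v : V} (hv : (T + S) v = 0)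
    {t : ℕ} (ht : (S ^ t) v = 0) : (T ^ t) v = 0 := by
  have hpow : ∀ k : ℕ, (T ^ k) v = ((-S) ^ k) v := by
    intro k
    induction k with
    | zero => simp
    | succ k ih =>
      have h1 : T v = (-S) v := eq_neg_of_add_eq_zero_left hv
      rw [pow_succ, Module.End.mul_apply, h1, ← Module.End.mul_apply,
        (hTS.neg_right.pow_left k).eq, Module.End.mul_apply, ih, ← Module.End.mul_apply,
        ← pow_succ']
  rw [hpow, neg_pow, Module.End.mul_apply, ht, map_zero]

/-- Let `d = d_α + d_s` be a linear derivation of `B_n^2` with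
`d_α(x_i) = α x_i` (α ≠ 0) scalar and `d_s` skew-symmetric. If `d_s` is locally
nilpotent, then `ker(d) = ℂ`. -/
theorem lnd_skew_part_trivial_constants
    (n : ℕ) (hn : 3 ≤ n) (α : ℂ) (hα : α ≠ 0)
    (dα ds : Derivation ℂ (FermatRing n fun _ => 2) (FermatRing n fun _ => 2))
    (hdα : ∀ i, dα (fx n (fun _ => 2) i) = α • fx n (fun _ => 2) i)
    (s : Matrix (Fin n) (Fin n) ℂ) (hs : s.transpose = -s)
    (hds : ∀ i, ds (fx n (fun _ => 2) i) = ∑ j, s i j • fx n (fun _ => 2) j)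
    (hln : ∀ r : FermatRing n fun _ => 2, ∃ t : ℕ, (⇑ds)^[t] r = 0) :
    {f : FermatRing n fun _ => 2 | (dα + ds) f = 0} =
      Set.range (algebraMap ℂ (FermatRing n fun _ => 2)) := by
  set B := FermatRing n fun _ => 2
  ext f
  simp only [Set.mem_ofPred_eq, Set.mem_range]
  refine ⟨fun hf => ?_, ?_⟩
  swap
  · rintro ⟨c, rfl⟩
    exact Derivation.map_algebraMap _ c
  have hbr : ⁅dα, ds⁆ = 0 := by
    refine FermatRing.derivation_ext fun i => ?_
    rw [Derivation.commutator_apply, hds, hdα, map_sum, Derivation.map_smul, hds,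
      Finset.smul_sum, Derivation.zero_apply, sub_eq_zero]
    refine Finset.sum_congr rfl fun j _ => ?_
    rw [Derivation.map_smul, hdα, smul_comm]
  have hcomm : Commute (dα : Module.End ℂ B) (ds : Module.End ℂ B) := by
    refine LinearMap.ext fun x => ?_
    have h := DFunLike.congr_fun hbr x
    rw [Derivation.commutator_apply, Derivation.zero_apply, sub_eq_zero] at h
    exact h
  obtain ⟨t, ht⟩ := hln f
  have hzero : ((dα : Module.End ℂ B) ^ t) f = 0 :=
    Module.End.pow_apply_eq_zero_of_commute hcomm hf ((Module.End.pow_apply _ t f).trans ht)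
  obtain ⟨p, rfl⟩ := Ideal.Quotient.mk_surjective f
  have hmem := fun k => FermatRing.mk_homogeneousComponent_mem_eigenspace hdα k p
  have hsum : (Ideal.Quotient.mk _ p : B) = ∑ k ∈ Finset.range (p.totalDegree + 1),
      (Ideal.Quotient.mk _ (homogeneousComponent k p) : B) := by
    rw [← map_sum, sum_homogeneousComponent]
  have hinj : Function.Injective fun k : ℕ => (k : ℂ) * α :=
    (mul_left_injective₀ hα).comp Nat.cast_injective
  rw [hsum, map_sum, Finset.sum_congr rfl fun k _ =>
    Module.End.pow_apply_of_mem_eigenspace (hmem k) t] at hzero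
  have hcomp := Module.End.eq_zero_of_sum_mem_eigenspace_eq_zero (dα : Module.End ℂ B) hinj
    (fun k _ => Submodule.smul_mem _ _ (hmem k)) hzero
  refine ⟨coeff 0 p, ?_⟩
  refine Eq.trans ?_ (hsum.trans (Finset.sum_eq_single_of_mem 0 (by simp) ?_)).symm
  · rw [homogeneousComponent_zero]; rfl
  · intro k hk hk0
    exact (smul_eq_zero.1 (hcomp k hk)).resolve_left
      (pow_ne_zero _ (mul_ne_zero (Nat.cast_ne_zero.2 hk0) hα))
end
end
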